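/- arXiv:1310.6855 — 3 statements merged into one kernel-verified Lean document; each statement's English description precedes it below -/
import Mathlib

section
/- Let k ≥ 2, let t₀, …, t_{k+1} be pairwise distinct real numbers, let U ⊆ ℝ^{k+1} be open and let w : U → ℝ be smooth. If there exists a single real number t* ∉ {t₀, …, t_{k+1}} such that the integrability condition E(t*) holds, then E(t) holds for every t ∈ ℝ. -/
open Finset

/-- Partial derivative in the `i`-th coordinate direction on `ℝⁿ = (Fin n → ℝ)`. -/
noncomputable def pd {n : ℕ} (i : Fin n) (f : (Fin n → ℝ) → ℝ) : (Fin n → ℝ) → ℝ :=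
  fun x => fderiv ℝ f x (Pi.single i 1)

/-- Splitting off two factors from a product over a finite set with one element removed. -/
theorem prod_erase_eq_mul_mul_prod_erase {ι : Type*} [DecidableEq ι] {s : Finset ι} (f : ι → ℝ)
    {i j l : ι} (hj : j ∈ s) (hl : l ∈ s) (hij : i ≠ j) (hil : i ≠ l) (hjl : j ≠ l) :
    ∏ m ∈ s.erase i, f m = f j * f l * ∏ m ∈ ((s.erase i).erase j).erase l, f m := by
  rw [mul_assoc, Finset.mul_prod_erase _ f (by simp [hl, hil.symm, hjl.symm]),
    Finset.mul_prod_erase _ f (by simp [hj, hij.symm])]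

/-- If the integrability condition `E(t*)` holds for one single value
`t* ∉ {t₀, …, t_{k+1}}`, then `E(t)` holds for every `t ∈ ℝ`. -/
theorem integrability_of_single_value
    (k : ℕ) (hk : 2 ≤ k) (ts : ℕ → ℝ)
    (hts : ∀ i j, i ≤ k + 1 → j ≤ k + 1 → i ≠ j → ts i ≠ ts j)
    (U : Set (Fin (k+1) → ℝ)) (hU : IsOpen U)
    (w : (Fin (k+1) → ℝ) → ℝ) (hw : ContDiffOn ℝ (⊤ : ℕ∞) w U)
    (T : ℕ → ℝ → ℝ)
    (hT : ∀ m t, T m t =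
      (ts (k+1) - ts m) * ∏ s ∈ (Finset.range (k+1)).erase m, (t - ts s))
    (tstar : ℝ) (htstar : ∀ m, m ≤ k + 1 → tstar ≠ ts m)
    (hE : ∀ x ∈ U, ∀ i j l : Fin (k+1), (i : ℕ) < j → (j : ℕ) < l →
      (T i tstar - T j tstar) * T l tstar * pd i (pd j w) x * pd l w x
        + (T j tstar - T l tstar) * T i tstar * pd j (pd l w) x * pd i w x
        + (T l tstar - T i tstar) * T j tstar * pd l (pd i w) x * pd j w x = 0) :
    ∀ t : ℝ, ∀ x ∈ U, ∀ i j l : Fin (k+1), (i : ℕ) < j → (j : ℕ) < l →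
      (T i t - T j t) * T l t * pd i (pd j w) x * pd l w x
        + (T j t - T l t) * T i t * pd j (pd l w) x * pd i w x
        + (T l t - T i t) * T j t * pd l (pd i w) x * pd j w x = 0 := by
  intro t x hx i j l hij hjl
  set S := (((range (k + 1)).erase (i : ℕ)).erase (j : ℕ)).erase (l : ℕ) with hS
  have hi : (i : ℕ) ∈ range (k + 1) := mem_range.2 i.2
  have hj : (j : ℕ) ∈ range (k + 1) := mem_range.2 j.2
  have hl : (l : ℕ) ∈ range (k + 1) := mem_range.2 l.2
  have hij' : (i : ℕ) ≠ j := by omega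
  have hjl' : (j : ℕ) ≠ l := by omega
  have hil' : (i : ℕ) ≠ l := by omega
  have hTi : ∀ u, T i u = (ts (k+1) - ts i) * ((u - ts j) * (u - ts l) * ∏ s ∈ S, (u - ts s)) :=
    fun u => by
      rw [hT, prod_erase_eq_mul_mul_prod_erase (fun s => u - ts s) hj hl hij' hil' hjl']
  have hTj : ∀ u, T j u = (ts (k+1) - ts j) * ((u - ts i) * (u - ts l) * ∏ s ∈ S, (u - ts s)) :=
    fun u => by
      rw [hT, prod_erase_eq_mul_mul_prod_erase (fun s => u - ts s) hi hl hij'.symm hjl' hil',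
        erase_right_comm (a := (j : ℕ))]
  have hTl : ∀ u, T l u = (ts (k+1) - ts l) * ((u - ts i) * (u - ts j) * ∏ s ∈ S, (u - ts s)) :=
    fun u => by
      rw [hT, prod_erase_eq_mul_mul_prod_erase (fun s => u - ts s) hi hj hil'.symm hjl'.symm hij',
        erase_right_comm (a := (l : ℕ)), erase_right_comm (a := (l : ℕ))]
  have key : ∀ u A B C : ℝ,
      (T i u - T j u) * T l u * A + (T j u - T l u) * T i u * B + (T l u - T i u) * T j u * C =
        ((∏ s ∈ S, (u - ts s)) ^ 2 * (u - ts i) * (u - ts j) * (u - ts l) * (ts (k+1) - u)) *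
          ((ts i - ts j) * (ts (k+1) - ts l) * A + (ts j - ts l) * (ts (k+1) - ts i) * B
            + (ts l - ts i) * (ts (k+1) - ts j) * C) := by
    intro u A B C
    rw [hTi, hTj, hTl]
    ring
  have hne : ∀ m, m ≤ k + 1 → tstar - ts m ≠ 0 := fun m hm => sub_ne_zero.2 (htstar m hm)
  have hprod : ∏ s ∈ S, (tstar - ts s) ≠ 0 := prod_ne_zero_iff.2 fun s hs => by
    simp only [hS, mem_erase, mem_range] at hs
    exact hne s (by omega)
  have h := hE x hx i j l hij hjl
  simp only [mul_assoc _ (pd _ (pd _ w) x)] at h ⊢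
  rw [key] at h ⊢
  have hlast : ts (k+1) - tstar ≠ 0 := sub_ne_zero.2 (htstar (k+1) le_rfl).symm
  rw [(mul_eq_zero.1 h).resolve_left
    (mul_ne_zero (mul_ne_zero (mul_ne_zero (mul_ne_zero (pow_ne_zero 2 hprod)
      (hne i (by omega))) (hne j (by omega))) (hne l (by omega))) hlast), mul_zero]
end

section
/- Let F : ℝ⁴ → ℝ be smooth and U ⊆ ℝ⁴ open. Assume that on U the Wünschmann condition K₀ + (1/2)·X_F(K₁) = 0 holds and the Cartan condition 2·V'(K₁) + V(X_F(K₁)) = 0 holds. Then on U one has K₁·V(K₁) = 2·V''(K₁) − V'(K₀). -/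
namespace Order3

/- Coordinates on `ℝ⁴` are `(t, x₀, x₁, x₂)`, i.e. `∂_t = pd 0`, `∂₀ = pd 1`,
`∂₁ = pd 2`, `∂₂ = pd 3`, and `x₁ = p 2`, `x₂ = p 3`. -/

/-- Total derivative `X_F = ∂_t + x₁·∂₀ + x₂·∂₁ + F·∂₂` of the ODE `x''' = F(t,x,x',x'')`. -/
noncomputable def XF (F : (Fin 4 → ℝ) → ℝ) (u : (Fin 4 → ℝ) → ℝ) : (Fin 4 → ℝ) → ℝ :=
  fun p => pd 0 u p + p 2 * pd 1 u p + p 3 * pd 2 u p + F p * pd 3 u p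

/-- The curvature `K₀`. -/
noncomputable def K0 (F : (Fin 4 → ℝ) → ℝ) : (Fin 4 → ℝ) → ℝ := fun p =>
  pd 1 F p - XF F (pd 2 F) p + (1/3) * pd 2 F p * pd 3 F p
    + (2/3) * XF F (XF F (pd 3 F)) p - (2/3) * XF F (pd 3 F) p * pd 3 F p
    + (2/27) * (pd 3 F p)^3

/-- The curvature `K₁ = ∂₁F − X_F(∂₂F) + (1/3)(∂₂F)²`. -/
noncomputable def K1 (F : (Fin 4 → ℝ) → ℝ) : (Fin 4 → ℝ) → ℝ := fun p =>
  pd 2 F p - XF F (pd 3 F) p + (1/3) * (pd 3 F p)^2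

/-- The operator `V = ∂₂`. -/
noncomputable def V (u : (Fin 4 → ℝ) → ℝ) : (Fin 4 → ℝ) → ℝ := pd 3 u

/-- The operator `V' = −∂₁ − (2/3)∂₂F·∂₂`. -/
noncomputable def V' (F : (Fin 4 → ℝ) → ℝ) (u : (Fin 4 → ℝ) → ℝ) : (Fin 4 → ℝ) → ℝ :=
  fun p => -(pd 2 u p) - (2/3) * pd 3 F p * pd 3 u p

/-- The operator `V'' = ∂₀ + (1/3)∂₂F·∂₁ + (∂₁F + (4/9)(∂₂F)² − (2/3)X_F(∂₂F))·∂₂`. -/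
noncomputable def V'' (F : (Fin 4 → ℝ) → ℝ) (u : (Fin 4 → ℝ) → ℝ) : (Fin 4 → ℝ) → ℝ :=
  fun p => pd 1 u p + (1/3) * pd 3 F p * pd 2 u p
    + (pd 2 F p + (4/9) * (pd 3 F p)^2 - (2/3) * XF F (pd 3 F) p) * pd 3 u p

end Order3

open scoped ContDiff

/-- The algebra of smooth real functions on `ℝⁿ`. -/
def smoothSubalgebra (n : ℕ) : Subalgebra ℝ ((Fin n → ℝ) → ℝ) where
  carrier := {f | ContDiff ℝ ∞ f}
  mul_mem' {f g} (hf : ContDiff ℝ ∞ f) (hg : ContDiff ℝ ∞ g) := hf.mul hg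
  add_mem' {f g} (hf : ContDiff ℝ ∞ f) (hg : ContDiff ℝ ∞ g) := hf.add hg
  algebraMap_mem' c := (contDiff_const : ContDiff ℝ ∞ fun _ : Fin n → ℝ => c)

namespace smoothSubalgebra

variable {n : ℕ}

lemma contDiff (f : smoothSubalgebra n) : ContDiff ℝ ∞ (f : (Fin n → ℝ) → ℝ) := f.2

lemma differentiableAt (f : smoothSubalgebra n) (p : Fin n → ℝ) :
    DifferentiableAt ℝ (f : (Fin n → ℝ) → ℝ) p :=
  (contDiff f).differentiable (by simp) p

/-- The partial derivative `pd i` as a derivation of the algebra of smooth functions. -/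
noncomputable def partialDeriv (i : Fin n) :
    Derivation ℝ (smoothSubalgebra n) (smoothSubalgebra n) :=
  Derivation.mk'
    { toFun := fun f =>
        ⟨pd i f, ((contDiff f).fderiv_right (m := ∞) (by simp)).clm_apply contDiff_const⟩
      map_add' := fun f g => by
        ext p
        simp [pd, fderiv_add (differentiableAt f p) (differentiableAt g p)]
      map_smul' := fun c f => by
        ext p
        simp [pd, fderiv_const_smul (differentiableAt f p)] }
    fun f g => by
      ext p
      simp [pd, fderiv_mul (differentiableAt f p) (differentiableAt g p)]

@[simp]
lemma coe_partialDeriv (i : Fin n) (f : smoothSubalgebra n) :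
    (partialDeriv i f : (Fin n → ℝ) → ℝ) = pd i f := rfl

lemma partialDeriv_comm (i j : Fin n) (f : smoothSubalgebra n) :
    partialDeriv i (partialDeriv j f) = partialDeriv j (partialDeriv i f) := by
  ext p
  have hd : DifferentiableAt ℝ (fderiv ℝ (f : (Fin n → ℝ) → ℝ)) p :=
    (((contDiff f).fderiv_right (m := ∞) (by simp)).differentiable (by simp)) p
  have hpd (k l : Fin n) : pd k (pd l (f : (Fin n → ℝ) → ℝ)) p =
      fderiv ℝ (fderiv ℝ (f : (Fin n → ℝ) → ℝ)) p (Pi.single k 1) (Pi.single l 1) := by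
    unfold pd
    rw [fderiv_clm_apply hd (differentiableAt_const _)]
    simp
  have hsymm : IsSymmSndFDerivAt ℝ (f : (Fin n → ℝ) → ℝ) p :=
    (contDiff f).contDiffAt.isSymmSndFDerivAt (by simpa using ENat.LEInfty.out)
  simpa only [coe_partialDeriv, hpd] using hsymm.eq _ _

/-- The `i`-th coordinate function. -/
def coord (i : Fin n) : smoothSubalgebra n :=
  ⟨fun p => p i, (contDiff_apply ℝ ℝ i : ContDiff ℝ ∞ fun p : Fin n → ℝ => p i)⟩

lemma partialDeriv_coord (i j : Fin n) :
    partialDeriv i (coord j) = if i = j then 1 else 0 := by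
  ext p
  have h : HasFDerivAt (fun q : Fin n → ℝ => q j)
      (ContinuousLinearMap.proj (R := ℝ) (φ := fun _ : Fin n => ℝ) j) p := hasFDerivAt_apply j p
  simp only [coe_partialDeriv, pd, coord, h.fderiv]
  split_ifs with hij
  · simp [hij]
  · simp [Pi.single_eq_of_ne (Ne.symm hij)]

/-- The total derivative `X_F` as a derivation of the algebra of smooth functions. -/
noncomputable def totalDeriv (F : smoothSubalgebra 4) :
    Derivation ℝ (smoothSubalgebra 4) (smoothSubalgebra 4) :=
  partialDeriv 0 + (coord 2 : smoothSubalgebra 4) • partialDeriv 1 +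
    (coord 3 : smoothSubalgebra 4) • partialDeriv 2 + F • partialDeriv 3

@[simp]
lemma coe_totalDeriv (F u : smoothSubalgebra 4) :
    (totalDeriv F u : (Fin 4 → ℝ) → ℝ) = Order3.XF F u := rfl

lemma partialDeriv_three_totalDeriv (F u : smoothSubalgebra 4) :
    partialDeriv 3 (totalDeriv F u) = totalDeriv F (partialDeriv 3 u) + partialDeriv 2 u +
      partialDeriv 3 F * partialDeriv 3 u := by
  simp [totalDeriv, partialDeriv_coord, partialDeriv_comm 3 0 u, partialDeriv_comm 3 1 u,
    partialDeriv_comm 3 2 u]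
  ring

lemma partialDeriv_two_totalDeriv (F u : smoothSubalgebra 4) :
    partialDeriv 2 (totalDeriv F u) = totalDeriv F (partialDeriv 2 u) + partialDeriv 1 u +
      partialDeriv 2 F * partialDeriv 3 u := by
  simp [totalDeriv, partialDeriv_coord, partialDeriv_comm 2 0 u, partialDeriv_comm 2 1 u,
    partialDeriv_comm 2 3 u]
  ring

lemma partialDeriv_one_totalDeriv (F u : smoothSubalgebra 4) :
    partialDeriv 1 (totalDeriv F u) = totalDeriv F (partialDeriv 1 u) +
      partialDeriv 1 F * partialDeriv 3 u := by
  simp [totalDeriv, partialDeriv_coord, partialDeriv_comm 1 0 u, partialDeriv_comm 1 2 u,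
    partialDeriv_comm 1 3 u]
  ring

end smoothSubalgebra

/-- The differential identity expressing the defect of `K₁·V(K₁) = 2V''(K₁) − V'(K₀)` through
the Wünschmann expression `w` and the Cartan expression `c`, for derivations `X`, `D₀`, `D₁`, `D₂`
satisfying the commutation relations of `X_F`, `∂₀`, `∂₁`, `∂₂`. -/
lemma Derivation.cartan_wunschmann_identity {A : Type*} [CommRing A] [Algebra ℝ A]
    (X D₀ D₁ D₂ : Derivation ℝ A A) (F k₀ k₁ w c : A)
    (comm₂ : ∀ u, D₂ (X u) = X (D₂ u) + D₁ u + D₂ F * D₂ u)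
    (comm₁ : ∀ u, D₁ (X u) = X (D₁ u) + D₀ u + D₁ F * D₂ u)
    (comm₀ : ∀ u, D₀ (X u) = X (D₀ u) + D₀ F * D₂ u)
    (comm₂₁ : ∀ u, D₂ (D₁ u) = D₁ (D₂ u))
    (comm₂₀ : ∀ u, D₂ (D₀ u) = D₀ (D₂ u))
    (comm₁₀ : ∀ u, D₁ (D₀ u) = D₀ (D₁ u))
    (hk₀ : k₀ = D₀ F - X (D₁ F) + (1 / 3 : ℝ) • (D₁ F * D₂ F) + (2 / 3 : ℝ) • X (X (D₂ F))
      - (2 / 3 : ℝ) • (X (D₂ F) * D₂ F) + (2 / 27 : ℝ) • (D₂ F * (D₂ F * D₂ F)))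
    (hk₁ : k₁ = D₁ F - X (D₂ F) + (1 / 3 : ℝ) • (D₂ F * D₂ F))
    (hw : w = k₀ + (1 / 2 : ℝ) • X k₁)
    (hc : c = (2 : ℝ) • (-D₁ k₁ - (2 / 3 : ℝ) • (D₂ F * D₂ k₁)) + D₂ (X k₁)) :
    k₁ * D₂ k₁ - ((2 : ℝ) • (D₀ k₁ + (1 / 3 : ℝ) • (D₂ F * D₁ k₁)
        + (D₁ F + (4 / 9 : ℝ) • (D₂ F * D₂ F) - (2 / 3 : ℝ) • X (D₂ F)) * D₂ k₁)
        - (-D₁ k₀ - (2 / 3 : ℝ) • (D₂ F * D₂ k₀))) =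
      (4 : ℝ) • (-D₁ w - (2 / 3 : ℝ) • (D₂ F * D₂ w))
        + (3 / 2 : ℝ) • (X (D₂ w) + (1 / 3 : ℝ) • (D₂ F * D₂ w))
        + (1 / 4 : ℝ) • (X c + (1 / 3 : ℝ) • (D₂ F * c)) + (2 : ℝ) • (D₂ (D₂ F) * w) := by
  subst hw hc hk₀ hk₁
  simp only [map_add, map_sub, map_neg, Derivation.leibniz, Derivation.map_smul, comm₂, comm₁,
    comm₀, comm₂₁, comm₂₀, comm₁₀, smul_eq_mul]
  algebra

lemma pd_eq_zero_of_eqOn {n : ℕ} {U : Set (Fin n → ℝ)} (hU : IsOpen U)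
    {f : (Fin n → ℝ) → ℝ} (hf : ∀ p ∈ U, f p = 0) (i : Fin n) :
    ∀ p ∈ U, pd i f p = 0 := fun p hp => by
  have h : f =ᶠ[nhds p] fun _ => 0 := Filter.eventually_of_mem (hU.mem_nhds hp) hf
  simp [pd, h.fderiv_eq]

lemma Order3.XF_eq_zero_of_eqOn {U : Set (Fin 4 → ℝ)} (hU : IsOpen U)
    (F : (Fin 4 → ℝ) → ℝ) {f : (Fin 4 → ℝ) → ℝ} (hf : ∀ p ∈ U, f p = 0) :
    ∀ p ∈ U, XF F f p = 0 := fun p hp => by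
  simp [XF, pd_eq_zero_of_eqOn hU hf _ p hp]

open Order3 in
/-- lemma in the proof of Theorem 7.1: if the Wünschmann condition
`K₀ + (1/2)X_F(K₁) = 0` and the Cartan condition `2V'(K₁) + V(X_F(K₁)) = 0` hold on an
open set `U`, then `K₁·V(K₁) = 2V''(K₁) − V'(K₀)` on `U`. -/
theorem lemma_thm_ord3 (F : (Fin 4 → ℝ) → ℝ) (hF : ContDiff ℝ (⊤ : ℕ∞) F)
    (U : Set (Fin 4 → ℝ)) (hU : IsOpen U)
    (hWun : ∀ p ∈ U, K0 F p + (1/2) * XF F (K1 F) p = 0)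
    (hCartan : ∀ p ∈ U, 2 * V' F (K1 F) p + V (XF F (K1 F)) p = 0) :
    ∀ p ∈ U, K1 F p * V (K1 F) p = 2 * V'' F (K1 F) p - V' F (K0 F) p := by
  intro p hp
  let f : smoothSubalgebra 4 := ⟨F, hF⟩
  let X := smoothSubalgebra.totalDeriv f
  let D (i : Fin 4) := smoothSubalgebra.partialDeriv i
  let k₀ : smoothSubalgebra 4 := D 1 f - X (D 2 f) + (1 / 3 : ℝ) • (D 2 f * D 3 f)
    + (2 / 3 : ℝ) • X (X (D 3 f)) - (2 / 3 : ℝ) • (X (D 3 f) * D 3 f)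
    + (2 / 27 : ℝ) • (D 3 f * (D 3 f * D 3 f))
  let k₁ : smoothSubalgebra 4 := D 2 f - X (D 3 f) + (1 / 3 : ℝ) • (D 3 f * D 3 f)
  let w : smoothSubalgebra 4 := k₀ + (1 / 2 : ℝ) • X k₁
  let c : smoothSubalgebra 4 :=
    (2 : ℝ) • (-D 2 k₁ - (2 / 3 : ℝ) • (D 3 f * D 3 k₁)) + D 3 (X k₁)
  have hk₀ : (k₀ : (Fin 4 → ℝ) → ℝ) = K0 F := by
    ext q
    simp [k₀, K0, X, D, f]
    ring
  have hk₁ : (k₁ : (Fin 4 → ℝ) → ℝ) = K1 F := by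
    ext q
    simp [k₁, K1, X, D, f]
    ring
  have hw : ∀ q ∈ U, (w : (Fin 4 → ℝ) → ℝ) q = 0 := fun q hq => by
    rw [← hWun q hq]
    simp [w, hk₀, hk₁, X, f]
  have hc : ∀ q ∈ U, (c : (Fin 4 → ℝ) → ℝ) q = 0 := fun q hq => by
    rw [← hCartan q hq]
    simp [c, hk₁, X, D, f, V, V']
    ring
  have key := Derivation.cartan_wunschmann_identity X (D 1) (D 2) (D 3) f k₀ k₁ w c
    (smoothSubalgebra.partialDeriv_three_totalDeriv f)
    (smoothSubalgebra.partialDeriv_two_totalDeriv f)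
    (smoothSubalgebra.partialDeriv_one_totalDeriv f)
    (smoothSubalgebra.partialDeriv_comm 3 2) (smoothSubalgebra.partialDeriv_comm 3 1)
    (smoothSubalgebra.partialDeriv_comm 2 1) rfl rfl rfl rfl
  have keyp := congrArg (fun u : smoothSubalgebra 4 => (u : (Fin 4 → ℝ) → ℝ) p) key
  simp [X, D, f, hk₀, hk₁, hw p hp, hc p hp, pd_eq_zero_of_eqOn hU hw _ p hp,
    XF_eq_zero_of_eqOn hU F hc p hp,
    XF_eq_zero_of_eqOn hU F (pd_eq_zero_of_eqOn hU hw 3) p hp] at keyp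
  simp only [V, V', V'']
  linear_combination keyp
end

section
/- (Core of Corollary 10.4: flat Veronese webs are exactly those with torsion-free canonical connection.) Let k ≥ 2 and let U = I₀ × ⋯ × I_k ⊆ ℝ^{k+1} be a product of open intervals. Let w : U → ℝ be smooth with ∂_i w nowhere vanishing on U for every i, and assume that for all pairwise distinct indices i, j, l ∈ {0,…,k} one has ∂_i∂_j w · ∂_l w = ∂_i∂_l w · ∂_j w on U (equivalently ∂_i(∂_j w / ∂_l w) = 0; this is the coordinate form of the vanishing of the torsion of the canonical connection of the Veronese web defined by w). Then there exist smooth functions B₀, …, B_k with B_i : I_i → ℝ having nowhere-vanishing derivative, and a smooth function h : J → ℝ with nowhere-vanishing derivative defined on the interval J = {B₀(x₀) + ⋯ + B_k(x_k) : x ∈ U}, such that w(x) = h(B₀(x₀) + ⋯ + B_k(x_k)) for all x ∈ U; in particular, after the coordinate change x̃_i := B_i(x_i) the web is described by the flat function x̃₀ + ⋯ + x̃_k. -/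
open Finset

open Set in
/-- A differentiable function on a convex open set takes equal values at two points when its
derivative vanishes in the direction joining them. -/
theorem Convex.eq_of_fderiv_apply_sub_eq_zero {E : Type*} [NormedAddCommGroup E]
    [NormedSpace ℝ E] {V : Set E} (hV : Convex ℝ V) (hVo : IsOpen V) {f : E → ℝ}
    (hf : DifferentiableOn ℝ f V) {x y : E} (hx : x ∈ V) (hy : y ∈ V)
    (h : ∀ z ∈ V, fderiv ℝ f z (y - x) = 0) : f x = f y := by
  have hmem : ∀ t ∈ Icc (0 : ℝ) 1, x + t • (y - x) ∈ V := fun t ht =>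
    hV.add_smul_sub_mem hx hy ht
  have hder : ∀ t ∈ Icc (0 : ℝ) 1, HasDerivAt (fun t : ℝ => f (x + t • (y - x))) 0 t := by
    intro t ht
    have hline : HasDerivAt (fun t : ℝ => x + t • (y - x)) (y - x) t := by
      simpa using ((hasDerivAt_id t).smul_const (y - x)).const_add x
    have hfz := (hf.differentiableAt (hVo.mem_nhds (hmem t ht))).hasFDerivAt
    have := hfz.comp_hasDerivAt t hline
    rwa [h _ (hmem t ht)] at this
  have := constant_of_has_deriv_right_zero
    (fun t ht => (hder t ht).continuousAt.continuousWithinAt)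
    (fun t ht => (hder t (Ico_subset_Icc_self ht)).hasDerivWithinAt) 1 (by simp)
  simpa using this.symm

/-- The derivative in direction `v` is the combination of the partial derivatives with
coefficients the coordinates of `v`. -/
theorem fderiv_apply_eq_sum_pd {n : ℕ} (f : (Fin n → ℝ) → ℝ) (x v : Fin n → ℝ) :
    fderiv ℝ f x v = ∑ i, v i * pd i f x := by
  conv_lhs => rw [pi_eq_sum_univ' v]
  simp [pd]

/-- The partial derivatives of a smooth function on an open set are smooth. -/
theorem ContDiffOn.partialDeriv {n : ℕ} {f : (Fin n → ℝ) → ℝ} {U : Set (Fin n → ℝ)}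
    (hf : ContDiffOn ℝ (⊤ : ℕ∞) f U) (hU : IsOpen U) (i : Fin n) :
    ContDiffOn ℝ (⊤ : ℕ∞) (pd i f) U :=
  (hf.fderiv_of_isOpen hU (by simp)).clm_apply contDiffOn_const

/-- A smooth function on an open interval has a smooth primitive. -/
theorem ContDiffOn.exists_primitive {I : Set ℝ} (hI : IsOpen I) (hc : I.OrdConnected)
    {b : ℝ → ℝ} (hb : ContDiffOn ℝ (⊤ : ℕ∞) b I) :
    ∃ B : ℝ → ℝ, ContDiffOn ℝ (⊤ : ℕ∞) B I ∧ ∀ s ∈ I, deriv B s = b s := by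
  obtain rfl | ⟨p, hp⟩ := I.eq_empty_or_nonempty
  · exact ⟨b, hb, by simp⟩
  have hB : ∀ s ∈ I, HasDerivAt (fun u => ∫ t in p..u, b t) (b s) s := fun s hs =>
    intervalIntegral.integral_hasDerivAt_right
      ((hb.continuousOn.mono (hc.uIcc_subset hp hs)).intervalIntegrable)
      (hb.continuousOn.stronglyMeasurableAtFilter hI s hs)
      (hb.continuousOn.continuousAt (hI.mem_nhds hs))
  refine ⟨fun u => ∫ t in p..u, b t, ?_, fun s hs => (hB s hs).deriv⟩
  rw [contDiffOn_infty_iff_deriv_of_isOpen hI]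
  exact ⟨fun s hs => (hB s hs).differentiableAt.differentiableWithinAt,
    hb.congr fun s hs => (hB s hs).deriv⟩

/-- A smooth function on an open interval with nowhere-vanishing derivative is a diffeomorphism
onto an open interval. -/
theorem ContDiffOn.exists_openPartialHomeomorph {I : Set ℝ} (hI : IsOpen I)
    (hc : I.OrdConnected) {B : ℝ → ℝ} (hB : ContDiffOn ℝ (⊤ : ℕ∞) B I)
    (hB0 : ∀ s ∈ I, deriv B s ≠ 0) :
    ∃ e : OpenPartialHomeomorph ℝ ℝ, e.source = I ∧ (e : ℝ → ℝ) = B ∧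
      e.target.OrdConnected ∧ ContDiffOn ℝ (⊤ : ℕ∞) e.symm e.target ∧
      ∀ s ∈ I, HasDerivAt e.symm (deriv B s)⁻¹ (B s) := by
  have hat : ∀ s ∈ I, ContDiffAt ℝ (⊤ : ℕ∞) B s := fun s hs => hB.contDiffAt (hI.mem_nhds hs)
  have hder : ∀ s ∈ I, HasDerivAt B (deriv B s) s := fun s hs =>
    ((hat s hs).differentiableAt (by simp)).hasDerivAt
  have hinj : Set.InjOn B I := by
    intro x hx y hy hxy
    by_contra hne
    wlog hlt : x < y generalizing x y
    · exact this hy hx hxy.symm (Ne.symm hne) (lt_of_le_of_ne (not_lt.mp hlt) (Ne.symm hne))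
    have hsub : Set.Icc x y ⊆ I := hc.out hx hy
    obtain ⟨z, hz, hz0⟩ := exists_deriv_eq_zero hlt (hB.continuousOn.mono hsub) hxy
    exact hB0 z (hsub (Set.Ioo_subset_Icc_self hz)) hz0
  have hopen : IsOpenMap (I.domRestrict (hinj.bijOn_image.toPartialEquiv B I (B '' I))) := by
    rw [isOpenMap_iff_nhds_le]
    rintro ⟨s, hs⟩
    have hstrict := (hat s hs).hasStrictDerivAt (by simp)
    have hmap := hstrict.map_nhds_eq (hB0 s hs)
    change nhds (B s) ≤ Filter.map (B ∘ Subtype.val) (nhds (⟨s, hs⟩ : I))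
    rw [← Filter.map_map, map_nhds_subtype_coe_eq_nhds hs (hI.mem_nhds hs), hmap]
  let e := OpenPartialHomeomorph.ofContinuousOpenRestrict
    (hinj.bijOn_image.toPartialEquiv B I (B '' I)) hB.continuousOn hopen hI
  have htarget : e.target = B '' I := rfl
  have hleft : ∀ s ∈ I, e.symm (B s) = s := fun s hs => e.left_inv hs
  have hmem : ∀ s ∈ I, B s ∈ e.target := fun s hs => ⟨s, hs, rfl⟩
  refine ⟨e, rfl, rfl, ?_, ?_, ?_⟩
  · rw [htarget]
    exact (hc.isPreconnected.image B hB.continuousOn).ordConnected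
  · rintro _ ⟨s, hs, rfl⟩
    refine (e.contDiffAt_symm_deriv (hB0 s hs) (hmem s hs) ?_ ?_).contDiffWithinAt
    · rw [hleft s hs]; exact hder s hs
    · rw [hleft s hs]; exact hat s hs
  · intro s hs
    refine e.hasDerivAt_symm (hmem s hs) (hB0 s hs) ?_
    rw [hleft s hs]; exact hder s hs

/-- If every ratio `∂_j w / ∂_l w` is constant in the remaining coordinates of a box, then the
partial derivatives of `w` are proportional to functions of one variable each. -/
theorem exists_pd_mul_eq_pd_mul {n : ℕ} (hn : 3 ≤ n) {I : Fin n → Set ℝ}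
    (hIopen : ∀ i, IsOpen (I i)) (hIconn : ∀ i, (I i).OrdConnected)
    {w : (Fin n → ℝ) → ℝ} (hw : ContDiffOn ℝ (⊤ : ℕ∞) w (Set.pi Set.univ I))
    (hw0 : ∀ i, ∀ x ∈ Set.pi Set.univ I, pd i w x ≠ 0)
    (htor : ∀ i j l, i ≠ j → j ≠ l → i ≠ l → ∀ x ∈ Set.pi Set.univ I,
      pd i (pd j w) x * pd l w x = pd i (pd l w) x * pd j w x)
    {p : Fin n → ℝ} (hp : p ∈ Set.pi Set.univ I) :
    ∃ b : Fin n → ℝ → ℝ, (∀ i, ContDiffOn ℝ (⊤ : ℕ∞) (b i) (I i)) ∧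
      (∀ i, ∀ s ∈ I i, b i s ≠ 0) ∧
      ∀ i j, ∀ x ∈ Set.pi Set.univ I, pd i w x * b j (x j) = pd j w x * b i (x i) := by
  have hUo : IsOpen (Set.pi Set.univ I) := isOpen_set_pi Set.finite_univ fun i _ => hIopen i
  have hUc : Convex ℝ (Set.pi Set.univ I) := convex_pi fun i _ => (hIconn i).convex
  have hpd := hw.partialDeriv hUo
  have hdiff : ∀ i, ∀ x ∈ Set.pi Set.univ I, DifferentiableAt ℝ (pd i w) x := fun i x hx =>
    ((hpd i).contDiffAt (hUo.mem_nhds hx)).differentiableAt (by simp)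
  have hratio : ∀ j l, j ≠ l → ∀ x ∈ Set.pi Set.univ I, ∀ y ∈ Set.pi Set.univ I,
      x j = y j → x l = y l → pd j w x / pd l w x = pd j w y / pd l w y := by
    intro j l hjl x hx y hy hj hl
    simp only [div_eq_mul_inv]
    have hquot : ∀ z ∈ Set.pi Set.univ I, HasFDerivAt (fun x => pd j w x * (pd l w x)⁻¹)
        (pd j w z • -(pd l w z ^ 2)⁻¹ • fderiv ℝ (pd l w) z +
          (pd l w z)⁻¹ • fderiv ℝ (pd j w) z) z := fun z hz => (hdiff j z hz).hasFDerivAt.fun_mul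
      ((hasDerivAt_inv (hw0 l z hz)).comp_hasFDerivAt z (hdiff l z hz).hasFDerivAt)
    refine hUc.eq_of_fderiv_apply_sub_eq_zero hUo (f := fun x => pd j w x * (pd l w x)⁻¹)
      (fun z hz => (hquot z hz).differentiableAt.differentiableWithinAt)
      hx hy fun z hz => ?_
    rw [fderiv_apply_eq_sum_pd]
    refine Finset.sum_eq_zero fun i _ => ?_
    obtain rfl | hij := eq_or_ne i j
    · simp [hj]
    obtain rfl | hil := eq_or_ne i l
    · simp [hl]
    have htz := htor i j l hij hjl hil z hz
    have hlz := hw0 l z hz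
    have : pd i (fun x => pd j w x * (pd l w x)⁻¹) z = 0 := by
      rw [pd, (hquot z hz).fderiv]
      change pd j w z * (-(pd l w z ^ 2)⁻¹ * pd i (pd l w) z) +
        (pd l w z)⁻¹ * pd i (pd j w) z = 0
      field_simp
      linear_combination htz
    rw [this, mul_zero]
  have hupd : ∀ x ∈ Set.pi Set.univ I, ∀ i, ∀ s ∈ I i,
      Function.update x i s ∈ Set.pi Set.univ I := fun x hx i s hs =>
    (Set.update_mem_pi_iff_of_mem hx).2 fun _ => hs
  have : Nontrivial (Fin n) := Fin.nontrivial_iff_two_le.2 (by omega)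
  choose m hm using fun i : Fin n => exists_ne i
  let b : Fin n → ℝ → ℝ := fun i s => pd i w (Function.update p i s) /
    pd (m i) w (Function.update p i s) * pd (m i) w p
  have hb : ∀ i l, l ≠ i → ∀ s ∈ I i, b i s =
      pd i w (Function.update p i s) / pd l w (Function.update p i s) * pd l w p := by
    intro i l hl s hs
    have hu := hupd p hp i s hs
    obtain h | h := eq_or_ne (m i) l
    · subst h; rfl
    have h1 := hratio (m i) l h _ hu p hp (Function.update_of_ne (hm i) _ _)
      (Function.update_of_ne hl _ _)
    have := hw0 l _ hu
    have := hw0 (m i) _ hu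
    have := hw0 l p hp
    simp only [b]
    field_simp at h1 ⊢
    linear_combination (-pd i w (Function.update p i s)) * h1
  refine ⟨b, fun i => ?_, fun i s hs => ?_, fun i j x hx => ?_⟩
  · have hsm : ContDiffOn ℝ (⊤ : ℕ∞) (fun s => Function.update p i s) (I i) :=
      (contDiff_update _ p i).contDiffOn
    exact (((hpd i).comp hsm fun s hs => hupd p hp i s hs).div
      ((hpd (m i)).comp hsm fun s hs => hupd p hp i s hs)
      fun s hs => hw0 _ _ (hupd p hp i s hs)).mul contDiffOn_const
  · have hu := hupd p hp i s hs
    exact mul_ne_zero (div_ne_zero (hw0 _ _ hu) (hw0 _ _ hu)) (hw0 _ _ hp)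
  · obtain rfl | hij := eq_or_ne i j
    · rfl
    obtain ⟨l, hl⟩ : ∃ l, l ∉ ({i, j} : Finset (Fin n)) := by
      refine Finset.exists_mem_notMem_of_card_lt_card (t := Finset.univ) ?_ |>.imp fun _ h => h.2
      have := Finset.card_le_two (a := i) (b := j)
      rw [Finset.card_univ, Fintype.card_fin]
      omega
    simp only [Finset.mem_insert, Finset.mem_singleton, not_or, ← ne_eq] at hl
    obtain ⟨hli, hlj⟩ := hl
    have hxi : x i ∈ I i := hx i trivial
    have hxj : x j ∈ I j := hx j trivial
    have hy := hupd x hx l (p l) (hp l trivial)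
    have hui := hupd p hp i _ hxi
    have huj := hupd p hp j _ hxj
    have h1 := hratio i j hij x hx _ hy (by simp [hli.symm]) (by simp [hlj.symm])
    have h2 := hratio i l hli.symm _ hy _ hui (by simp [hli.symm]) (by simp [hli])
    have h3 := hratio j l hlj.symm _ hy _ huj (by simp [hlj.symm]) (by simp [hlj])
    rw [hb i l hli _ hxi, hb j l hlj _ hxj, ← h2, ← h3]
    have := hw0 j x hx
    have := hw0 j _ hy
    have := hw0 l _ hy
    field_simp at h1 ⊢
    linear_combination pd l w p * h1

/-- core of Corollary 10.4: if on a box `U = I₀ × ⋯ × I_k` a function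
`w` with nowhere-vanishing partial derivatives satisfies
`∂_i∂_j w·∂_l w = ∂_i∂_l w·∂_j w` for all pairwise distinct `i, j, l` (the vanishing of
the torsion of the canonical connection), then `w(x) = h(B₀(x₀) + ⋯ + B_k(x_k))` for
suitable functions `B_i` and `h` with nowhere-vanishing derivatives; i.e. the Veronese
web defined by `w` is flat. -/
theorem flat_iff_torsion_free
    (k : ℕ) (hk : 2 ≤ k)
    (I : Fin (k+1) → Set ℝ)
    (hIopen : ∀ i, IsOpen (I i)) (hIconn : ∀ i, (I i).OrdConnected)
    (U : Set (Fin (k+1) → ℝ)) (hUdef : U = Set.pi Set.univ I)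
    (w : (Fin (k+1) → ℝ) → ℝ) (hw : ContDiffOn ℝ (⊤ : ℕ∞) w U)
    (hw0 : ∀ i : Fin (k+1), ∀ x ∈ U, pd i w x ≠ 0)
    (htor : ∀ i j l : Fin (k+1), i ≠ j → j ≠ l → i ≠ l → ∀ x ∈ U,
      pd i (pd j w) x * pd l w x = pd i (pd l w) x * pd j w x) :
    ∃ (B : Fin (k+1) → ℝ → ℝ) (h : ℝ → ℝ),
      (∀ i, ContDiffOn ℝ (⊤ : ℕ∞) (B i) (I i)) ∧
      (∀ i, ∀ s ∈ I i, deriv (B i) s ≠ 0) ∧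
      ContDiffOn ℝ (⊤ : ℕ∞) h ((fun x => ∑ i : Fin (k+1), B i (x i)) '' U) ∧
      (∀ y ∈ (fun x => ∑ i : Fin (k+1), B i (x i)) '' U, deriv h y ≠ 0) ∧
      (∀ x ∈ U, w x = h (∑ i : Fin (k+1), B i (x i))) := by
  subst hUdef
  obtain hempty | ⟨p, hp⟩ := (Set.pi Set.univ I).eq_empty_or_nonempty
  · exact ⟨fun _ => id, id, fun _ => contDiffOn_id, by simp, by simp [hempty],
      by simp [hempty], by simp [hempty]⟩
  obtain ⟨b, hbs, hb0, hb⟩ := exists_pd_mul_eq_pd_mul (by omega) hIopen hIconn hw hw0 htor hp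
  choose B hBs hBd using fun i => (hbs i).exists_primitive (hIopen i) (hIconn i)
  have hB0 : ∀ i, ∀ s ∈ I i, deriv (B i) s ≠ 0 := fun i s hs => by
    rw [hBd i s hs]; exact hb0 i s hs
  choose e hsrc hcoe htc hsymm hinv using fun i =>
    (hBs i).exists_openPartialHomeomorph (hIopen i) (hIconn i) (hB0 i)
  have hUo : IsOpen (Set.pi Set.univ I) := isOpen_set_pi Set.finite_univ fun i _ => hIopen i
  let V : Set (Fin (k+1) → ℝ) := Set.pi Set.univ fun i => (e i).target
  have hVo : IsOpen V := isOpen_set_pi Set.finite_univ fun i _ => (e i).open_target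
  have hVc : Convex ℝ V := convex_pi fun i _ => (htc i).convex
  let φ : (Fin (k+1) → ℝ) → Fin (k+1) → ℝ := fun y i => (e i).symm (y i)
  let Φ : (Fin (k+1) → ℝ) → Fin (k+1) → ℝ := fun x i => B i (x i)
  have hφ : ∀ y ∈ V, φ y ∈ Set.pi Set.univ I := fun y hy i _ => by
    rw [← hsrc i]; exact (e i).map_target (hy i trivial)
  have hΦ : ∀ x ∈ Set.pi Set.univ I, Φ x ∈ V := fun x hx i _ => by
    have := (e i).map_source (x := x i) (by rw [hsrc i]; exact hx i trivial)
    rwa [hcoe i] at this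
  have hφΦ : ∀ x ∈ Set.pi Set.univ I, φ (Φ x) = x := fun x hx => funext fun i => by
    have := (e i).left_inv (x := x i) (by rw [hsrc i]; exact hx i trivial)
    rwa [hcoe i] at this
  have hΦφ : ∀ y ∈ V, Φ (φ y) = y := fun y hy => funext fun i => by
    have := (e i).right_inv (hy i trivial)
    rwa [hcoe i] at this
  have hφs : ContDiffOn ℝ (⊤ : ℕ∞) φ V := contDiffOn_pi.2 fun i =>
    (hsymm i).comp (contDiff_apply ℝ ℝ i).contDiffOn fun y hy => hy i trivial
  have hWs : ContDiffOn ℝ (⊤ : ℕ∞) (w ∘ φ) V := hw.comp hφs hφ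
  have hWd : ∀ y ∈ V, ∀ v, fderiv ℝ (w ∘ φ) y v =
      pd 0 w (φ y) / b 0 (φ y 0) * ∑ i, v i := by
    intro y hy v
    have hmem := hφ y hy
    have hφd : HasFDerivAt φ (ContinuousLinearMap.pi fun i =>
        (b i (φ y i))⁻¹ • ContinuousLinearMap.proj (R := ℝ) (φ := fun _ : Fin (k+1) => ℝ) i)
        y := by
      refine hasFDerivAt_pi.2 fun i => ?_
      have h1 := hinv i (φ y i) (hmem i trivial)
      rw [hBd i _ (hmem i trivial), show B i (φ y i) = y i from congrFun (hΦφ y hy) i] at h1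
      exact h1.comp_hasFDerivAt y (hasFDerivAt_apply i y)
    have hwd := ((hw.contDiffAt (hUo.mem_nhds hmem)).differentiableAt (by simp)).hasFDerivAt
    rw [(hwd.comp y hφd).fderiv, ContinuousLinearMap.comp_apply, fderiv_apply_eq_sum_pd,
      Finset.mul_sum]
    refine Finset.sum_congr rfl fun i _ => ?_
    have h1 := hb i 0 (φ y) hmem
    have := hb0 i _ (hmem i trivial)
    have := hb0 0 _ (hmem 0 trivial)
    simp only [ContinuousLinearMap.coe_pi', FunLike.coe_smul, Pi.smul_apply,
      ContinuousLinearMap.proj_apply, smul_eq_mul]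
    field_simp
    linear_combination v i * h1
  have hlevel : ∀ y ∈ V, ∀ z ∈ V, ∑ i, y i = ∑ i, z i → w (φ y) = w (φ z) := by
    intro y hy z hz hyz
    refine hVc.eq_of_fderiv_apply_sub_eq_zero hVo (hWs.differentiableOn (by simp)) hy hz
      fun u hu => ?_
    simp [hWd u hu, hyz]
  let g : ℝ → Fin (k+1) → ℝ := Function.invFunOn (fun y => ∑ i, y i) V
  have hh : ∀ y ∈ V, w (φ (g (∑ i, y i))) = w (φ y) := fun y hy =>
    hlevel _ (Function.invFunOn_mem ⟨y, hy, rfl⟩) _ hy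
      (Function.invFunOn_eq (f := fun y : Fin (k+1) → ℝ => ∑ i, y i) ⟨y, hy, rfl⟩)
  -- Near the value at `y`, the function `h` is `w ∘ φ` along a coordinate line through `y`.
  have hloc : ∀ y ∈ V, ContDiffAt ℝ (⊤ : ℕ∞) (fun t => w (φ (g t))) (∑ i, y i) ∧
      deriv (fun t => w (φ (g t))) (∑ i, y i) ≠ 0 := by
    intro y hy
    let ℓ : ℝ → Fin (k+1) → ℝ := fun t => y + (t - ∑ i, y i) • Pi.single 0 1
    have hℓs : ContDiff ℝ (⊤ : ℕ∞) ℓ :=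
      contDiff_const.add ((contDiff_id.sub contDiff_const).smul contDiff_const)
    have hℓy : ℓ (∑ i, y i) = y := by simp [ℓ]
    have hℓd : HasDerivAt ℓ (Pi.single 0 1) (∑ i, y i) := by
      simpa [ℓ] using (((hasDerivAt_id (∑ i, y i)).sub_const (∑ i, y i)).smul_const
        (Pi.single 0 1 : Fin (k+1) → ℝ)).const_add y
    have hev : (fun t => w (φ (g t))) =ᶠ[nhds (∑ i, y i)] (w ∘ φ) ∘ ℓ := by
      filter_upwards [hℓs.continuous.continuousAt.preimage_mem_nhds
        (hVo.mem_nhds (hℓy.symm ▸ hy))] with t ht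
      have hsum : ∑ i, ℓ t i = t := by
        simp [ℓ, Finset.sum_add_distrib, ← Finset.mul_sum]
      have := hh (ℓ t) ht
      rwa [hsum] at this
    have hWy : ContDiffAt ℝ (⊤ : ℕ∞) (w ∘ φ) (ℓ (∑ i, y i)) := by
      rw [hℓy]; exact hWs.contDiffAt (hVo.mem_nhds hy)
    refine ⟨(hWy.comp _ hℓs.contDiffAt).congr_of_eventuallyEq hev, ?_⟩
    rw [hev.deriv_eq,
      ((hWy.differentiableAt (by simp)).hasFDerivAt.comp_hasDerivAt _ hℓd).deriv, hℓy, hWd y hy]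
    have hmem := hφ y hy
    simpa using ⟨hw0 0 _ hmem, hb0 0 _ (hmem 0 trivial)⟩
  refine ⟨B, fun t => w (φ (g t)), hBs, hB0, ?_, ?_, fun x hx => ?_⟩
  · rintro _ ⟨x, hx, rfl⟩
    exact (hloc (Φ x) (hΦ x hx)).1.contDiffWithinAt
  · rintro _ ⟨x, hx, rfl⟩
    exact (hloc (Φ x) (hΦ x hx)).2
  · exact (congrArg w (hφΦ x hx)).symm.trans (hh (Φ x) (hΦ x hx)).symm
end
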